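/- arXiv:math/0501074 — 6 statements merged into one kernel-verified Lean document; each statement's English description precedes it below -/
import Mathlib

section
/- For every real number A > 1 and every point p = (x₁,y₁,x₂,y₂) ∈ ℝ⁴ with F_A(p) = 0, the derivative of F_A at p in the direction v₂(p) is strictly positive; explicitly, (DF_A)(p)(v₂(p)) = 4A(x₁² + x₂²) + y₁² + y₂² > 0. (This is the assertion in Weinstein's handle construction lemma that the hypersurface Σ_A = F_A⁻¹(0) is positively transverse to v₂.) -/
/-- The vector field `v₂ (x₁,y₁,x₂,y₂) = (2x₁, −y₁, 2x₂, −y₂)` on `ℝ⁴ = Fin 4 → ℝ`,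
with coordinates `p 0 = x₁`, `p 1 = y₁`, `p 2 = x₂`, `p 3 = y₂`. -/
def v₂ : (Fin 4 → ℝ) → (Fin 4 → ℝ) :=
  fun p => ![2 * p 0, -p 1, 2 * p 2, -p 3]

/-- `F_A (x₁,y₁,x₂,y₂) = A(x₁² + x₂²) − (y₁² + y₂²)/2 − 1`. -/
noncomputable def F (A : ℝ) : (Fin 4 → ℝ) → ℝ :=
  fun p => A * (p 0 ^ 2 + p 2 ^ 2) - (p 1 ^ 2 + p 3 ^ 2) / 2 - 1

theorem hasFDerivAt_F (A : ℝ) (p : Fin 4 → ℝ) :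
    HasFDerivAt (F A)
      ((2 * A * p 0) • ContinuousLinearMap.proj (R := ℝ) (φ := fun _ : Fin 4 => ℝ) 0 +
        (2 * A * p 2) • ContinuousLinearMap.proj (R := ℝ) (φ := fun _ : Fin 4 => ℝ) 2 -
        p 1 • ContinuousLinearMap.proj (R := ℝ) (φ := fun _ : Fin 4 => ℝ) 1 -
        p 3 • ContinuousLinearMap.proj (R := ℝ) (φ := fun _ : Fin 4 => ℝ) 3) p := by
  have hsq (i : Fin 4) := (hasFDerivAt_apply (𝕜 := ℝ) i p).pow 2
  have h := ((((hsq 0).add (hsq 2)).const_mul A).sub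
    (((hsq 1).add (hsq 3)).mul_const (2⁻¹ : ℝ))).sub_const 1
  refine h.congr_fderiv ?_
  ext v
  simp
  ring

theorem fderiv_F_v₂ (A : ℝ) (p : Fin 4 → ℝ) :
    fderiv ℝ (F A) p (v₂ p) = 4 * A * (p 0 ^ 2 + p 2 ^ 2) + p 1 ^ 2 + p 3 ^ 2 := by
  rw [(hasFDerivAt_F A p).fderiv]
  simp [v₂]
  ring

/-- On the hypersurface `Σ_A = F_A⁻¹(0)` (for `A > 1`), the derivative of `F_A` in the
direction `v₂` equals `4A(x₁² + x₂²) + y₁² + y₂²` and is strictly positive. -/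
theorem stmt_1 (A : ℝ) (hA : 1 < A) (p : Fin 4 → ℝ) (hp : F A p = 0) :
    fderiv ℝ (F A) p (v₂ p) = 4 * A * (p 0 ^ 2 + p 2 ^ 2) + p 1 ^ 2 + p 3 ^ 2 ∧
      0 < fderiv ℝ (F A) p (v₂ p) := by
  refine ⟨fderiv_F_v₂ A p, ?_⟩
  rw [fderiv_F_v₂]
  unfold F at hp
  nlinarith [sq_nonneg (p 1), sq_nonneg (p 3)]
end

section
/- For every real number A > 1, the set ℋ₂(A) = {p ∈ ℝ⁴ : f₂(p) ≥ −1 and F_A(p) ≤ 0}, equipped with the subspace topology from ℝ⁴, is homeomorphic to the product D² × D² of two closed unit disks, i.e., to (closed unit ball of ℝ²) × (closed unit ball of ℝ²). (This is the topological content of the claim in Weinstein's handle construction lemma that the region ℋ₂ is diffeomorphic to D² × D².) -/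
/-- `f₂ (x₁,y₁,x₂,y₂) = x₁² − y₁²/2 + x₂² − y₂²/2` on `ℝ⁴ = Fin 4 → ℝ`,
with coordinates `p 0 = x₁`, `p 1 = y₁`, `p 2 = x₂`, `p 3 = y₂`. -/
noncomputable def f₂ : (Fin 4 → ℝ) → ℝ :=
  fun p => p 0 ^ 2 - p 1 ^ 2 / 2 + p 2 ^ 2 - p 3 ^ 2 / 2

/-- The handle region `ℋ₂(A) = {p : f₂(p) ≥ −1 and F_A(p) ≤ 0}`. -/
noncomputable def H₂ (A : ℝ) : Set (Fin 4 → ℝ) :=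
  {p | -1 ≤ f₂ p ∧ F A p ≤ 0}

lemma mem_closedBall_zero_one_iff (z : EuclideanSpace ℝ (Fin 2)) :
    z ∈ Metric.closedBall (0 : EuclideanSpace ℝ (Fin 2)) 1 ↔ z 0 ^ 2 + z 1 ^ 2 ≤ 1 := by
  rw [mem_closedBall_zero_iff, ← sq_le_one_iff₀ (norm_nonneg z), EuclideanSpace.real_norm_sq_eq,
    Fin.sum_univ_two]

/-- If `u = |x|²` and `v = |y|²`, scaling `x` and `y` by the square roots of `A / (1 + v / 2)` and
`1 / (2 + 2 u)` gives squared norms `U` and `V`; the factors that undo this are the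
square roots of `(1 + V) / (A - U V)` and `2 (A + U) / (A - U V)`. -/
lemma sqrt_scaling_left_inv {A u v U V : ℝ} (hA : 1 < A) (hu : 0 ≤ u) (hv : 0 ≤ v)
    (h : A * u ≤ 1 + v / 2) (h' : v ≤ 2 + 2 * u)
    (hU : U = A / (1 + v / 2) * u) (hV : V = 1 / (2 + 2 * u) * v) :
    √((1 + V) / (A - U * V)) * √(A / (1 + v / 2)) = 1 ∧
      √(2 * (A + U) / (A - U * V)) * √(1 / (2 + 2 * u)) = 1 := by
  have h1 : 0 < 1 + v / 2 := by positivity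
  have h2 : 0 < 2 + 2 * u := by positivity
  have hU0 : 0 ≤ U := by rw [hU]; positivity
  have hV0 : 0 ≤ V := by rw [hV]; positivity
  have hU1 : U ≤ 1 := by rw [hU, div_mul_eq_mul_div, div_le_one h1]; exact h
  have hV1 : V ≤ 1 := by rw [hV, div_mul_eq_mul_div, div_le_one h2]; linarith
  have hD : 0 < A - U * V := by nlinarith
  have eU : U * (1 + v / 2) = A * u := by rw [hU]; field_simp
  have eV : V * (2 + 2 * u) = v := by rw [hV]; field_simp
  have eu : u * (A - U * V) = U * (1 + V) := by
    linear_combination -eU - U / 2 * eV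
  constructor
  · rw [← Real.sqrt_mul (by positivity), Real.sqrt_eq_one, div_mul_div_comm,
      div_eq_one_iff_eq (by positivity)]
    linear_combination (A - U * V) / 2 * eV - V * eu
  · rw [← Real.sqrt_mul (by positivity), Real.sqrt_eq_one, div_mul_div_comm,
      div_eq_one_iff_eq (by positivity)]
    linear_combination -2 * eu

lemma sqrt_scaling_right_inv {A u v U V : ℝ} (hA : 1 < A) (hU0 : 0 ≤ U) (hV0 : 0 ≤ V)
    (hU1 : U ≤ 1) (hV1 : V ≤ 1)
    (hu : u = (1 + V) / (A - U * V) * U) (hv : v = 2 * (A + U) / (A - U * V) * V) :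
    √(A / (1 + v / 2)) * √((1 + V) / (A - U * V)) = 1 ∧
      √(1 / (2 + 2 * u)) * √(2 * (A + U) / (A - U * V)) = 1 := by
  have hD : 0 < A - U * V := by nlinarith
  have hu0 : 0 ≤ u := by rw [hu]; positivity
  have hv0 : 0 ≤ v := by rw [hv]; positivity
  have eu : u * (A - U * V) = (1 + V) * U := by
    rw [hu, mul_right_comm, div_mul_cancel₀ _ hD.ne']
  have ev : v * (A - U * V) = 2 * (A + U) * V := by
    rw [hv, mul_right_comm, div_mul_cancel₀ _ hD.ne']
  constructor
  · rw [← Real.sqrt_mul (by positivity), Real.sqrt_eq_one, div_mul_div_comm,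
      div_eq_one_iff_eq (by positivity)]
    linear_combination -ev / 2
  · rw [← Real.sqrt_mul (by positivity), Real.sqrt_eq_one, div_mul_div_comm,
      div_eq_one_iff_eq (by positivity)]
    linear_combination -2 * eu

lemma scaling_mem_region {A u v U V : ℝ} (hA : 1 < A) (hU0 : 0 ≤ U) (hV0 : 0 ≤ V)
    (hU1 : U ≤ 1) (hV1 : V ≤ 1)
    (hu : u = (1 + V) / (A - U * V) * U) (hv : v = 2 * (A + U) / (A - U * V) * V) :
    A * u ≤ 1 + v / 2 ∧ v ≤ 2 + 2 * u := by
  have hD : 0 < A - U * V := by nlinarith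
  have eu : u * (A - U * V) = (1 + V) * U := by
    rw [hu, mul_right_comm, div_mul_cancel₀ _ hD.ne']
  have ev : v * (A - U * V) = 2 * (A + U) * V := by
    rw [hv, mul_right_comm, div_mul_cancel₀ _ hD.ne']
  constructor
  · refine le_of_mul_le_mul_right ?_ hD
    nlinarith [mul_nonneg (by positivity : 0 ≤ A * (1 + V)) (sub_nonneg.2 hU1)]
  · refine le_of_mul_le_mul_right ?_ hD
    nlinarith [mul_nonneg (by positivity : 0 ≤ A + U) (sub_nonneg.2 hV1)]

lemma mem_H₂_iff {A : ℝ} {p : Fin 4 → ℝ} :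
    p ∈ H₂ A ↔ A * (p 0 ^ 2 + p 2 ^ 2) ≤ 1 + (p 1 ^ 2 + p 3 ^ 2) / 2 ∧
      p 1 ^ 2 + p 3 ^ 2 ≤ 2 + 2 * (p 0 ^ 2 + p 2 ^ 2) := by
  simp only [H₂, f₂, F, Set.mem_ofPred_eq]
  constructor <;> rintro ⟨h, h'⟩ <;> constructor <;> linarith

lemma sqrt_mul_sq_add {c : ℝ} (hc : 0 ≤ c) (a b : ℝ) :
    (√c * a) ^ 2 + (√c * b) ^ 2 = c * (a ^ 2 + b ^ 2) := by
  rw [mul_pow, mul_pow, Real.sq_sqrt hc]; ring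

/-- Rescaling of the `x`- and `y`-planes mapping `H₂ A` onto the bidisk. -/
noncomputable def toBidisk (A : ℝ) (p : Fin 4 → ℝ) :
    EuclideanSpace ℝ (Fin 2) × EuclideanSpace ℝ (Fin 2) :=
  (!₂[√(A / (1 + (p 1 ^ 2 + p 3 ^ 2) / 2)) * p 0, √(A / (1 + (p 1 ^ 2 + p 3 ^ 2) / 2)) * p 2],
    !₂[√(1 / (2 + 2 * (p 0 ^ 2 + p 2 ^ 2))) * p 1, √(1 / (2 + 2 * (p 0 ^ 2 + p 2 ^ 2))) * p 3])

/-- The inverse of `toBidisk A` on the bidisk. -/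
noncomputable def ofBidisk (A : ℝ)
    (q : EuclideanSpace ℝ (Fin 2) × EuclideanSpace ℝ (Fin 2)) : Fin 4 → ℝ :=
  let U := q.1 0 ^ 2 + q.1 1 ^ 2
  let V := q.2 0 ^ 2 + q.2 1 ^ 2
  ![√((1 + V) / (A - U * V)) * q.1 0, √(2 * (A + U) / (A - U * V)) * q.2 0,
    √((1 + V) / (A - U * V)) * q.1 1, √(2 * (A + U) / (A - U * V)) * q.2 1]

lemma continuous_toBidisk (A : ℝ) : Continuous (toBidisk A) := by
  have h1 (p : Fin 4 → ℝ) : 1 + (p 1 ^ 2 + p 3 ^ 2) / 2 ≠ 0 := by positivity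
  have h2 (p : Fin 4 → ℝ) : 2 + 2 * (p 0 ^ 2 + p 2 ^ 2) ≠ 0 := by positivity
  have c1 : Continuous fun p : Fin 4 → ℝ ↦ √(A / (1 + (p 1 ^ 2 + p 3 ^ 2) / 2)) :=
    (continuous_const.div (by fun_prop) h1).sqrt
  have c2 : Continuous fun p : Fin 4 → ℝ ↦ √(1 / (2 + 2 * (p 0 ^ 2 + p 2 ^ 2))) :=
    (continuous_const.div (by fun_prop) h2).sqrt
  refine .prodMk ?_ ?_ <;> refine (PiLp.continuous_toLp 2 _).comp (continuous_pi fun i ↦ ?_) <;>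
    fin_cases i
  · exact c1.mul (continuous_apply 0)
  · exact c1.mul (continuous_apply 2)
  · exact c2.mul (continuous_apply 1)
  · exact c2.mul (continuous_apply 3)

lemma continuousOn_ofBidisk {A : ℝ} (hA : 1 < A) :
    ContinuousOn (ofBidisk A) {q | q.1 0 ^ 2 + q.1 1 ^ 2 ≤ 1 ∧ q.2 0 ^ 2 + q.2 1 ^ 2 ≤ 1} := by
  have h : ∀ q ∈ {q : EuclideanSpace ℝ (Fin 2) × EuclideanSpace ℝ (Fin 2) |
      q.1 0 ^ 2 + q.1 1 ^ 2 ≤ 1 ∧ q.2 0 ^ 2 + q.2 1 ^ 2 ≤ 1},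
      A - (q.1 0 ^ 2 + q.1 1 ^ 2) * (q.2 0 ^ 2 + q.2 1 ^ 2) ≠ 0 := by
    rintro q ⟨h1, h2⟩
    have := mul_le_one₀ h1 (by positivity) h2
    linarith
  have c1 := (ContinuousOn.div (f := fun q : EuclideanSpace ℝ (Fin 2) × EuclideanSpace ℝ (Fin 2) ↦
    1 + (q.2 0 ^ 2 + q.2 1 ^ 2)) (by fun_prop) (by fun_prop) h).sqrt
  have c2 := (ContinuousOn.div (f := fun q : EuclideanSpace ℝ (Fin 2) × EuclideanSpace ℝ (Fin 2) ↦
    2 * (A + (q.1 0 ^ 2 + q.1 1 ^ 2))) (by fun_prop) (by fun_prop) h).sqrt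
  refine continuousOn_pi.2 fun i ↦ ?_
  fin_cases i
  · exact c1.mul (by fun_prop)
  · exact c2.mul (by fun_prop)
  · exact c1.mul (by fun_prop)
  · exact c2.mul (by fun_prop)

lemma ofBidisk_mem_H₂ {A : ℝ} (hA : 1 < A)
    {q : EuclideanSpace ℝ (Fin 2) × EuclideanSpace ℝ (Fin 2)}
    (h1 : q.1 0 ^ 2 + q.1 1 ^ 2 ≤ 1) (h2 : q.2 0 ^ 2 + q.2 1 ^ 2 ≤ 1) : ofBidisk A q ∈ H₂ A := by
  have hD : 0 < A - (q.1 0 ^ 2 + q.1 1 ^ 2) * (q.2 0 ^ 2 + q.2 1 ^ 2) := by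
    have := mul_le_one₀ h1 (by positivity) h2
    linarith
  exact mem_H₂_iff.2 <| scaling_mem_region hA (by positivity) (by positivity) h1 h2
    (sqrt_mul_sq_add (by positivity) _ _) (sqrt_mul_sq_add (by positivity) _ _)

lemma toBidisk_mem {A : ℝ} (hA : 1 < A) {p : Fin 4 → ℝ} (hp : p ∈ H₂ A) :
    (toBidisk A p).1 ∈ Metric.closedBall (0 : EuclideanSpace ℝ (Fin 2)) 1 ∧
      (toBidisk A p).2 ∈ Metric.closedBall (0 : EuclideanSpace ℝ (Fin 2)) 1 := by
  obtain ⟨h, h'⟩ := mem_H₂_iff.1 hp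
  rw [mem_closedBall_zero_one_iff, mem_closedBall_zero_one_iff]
  constructor
  · refine (sqrt_mul_sq_add (by positivity) _ _).trans_le ?_
    rwa [div_mul_eq_mul_div, div_le_one (by positivity)]
  · refine (sqrt_mul_sq_add (by positivity) _ _).trans_le ?_
    rwa [div_mul_eq_mul_div, one_mul, div_le_one (by positivity)]

lemma ofBidisk_toBidisk {A : ℝ} (hA : 1 < A) {p : Fin 4 → ℝ} (hp : p ∈ H₂ A) :
    ofBidisk A (toBidisk A p) = p := by
  obtain ⟨h, h'⟩ := mem_H₂_iff.1 hp
  obtain ⟨e1, e2⟩ := sqrt_scaling_left_inv hA (by positivity) (by positivity) h h'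
    (sqrt_mul_sq_add (by positivity) (p 0) (p 2)) (sqrt_mul_sq_add (by positivity) (p 1) (p 3))
  funext i
  fin_cases i
  · exact (mul_assoc _ _ _).symm.trans ((congrArg (· * p 0) e1).trans (one_mul _))
  · exact (mul_assoc _ _ _).symm.trans ((congrArg (· * p 1) e2).trans (one_mul _))
  · exact (mul_assoc _ _ _).symm.trans ((congrArg (· * p 2) e1).trans (one_mul _))
  · exact (mul_assoc _ _ _).symm.trans ((congrArg (· * p 3) e2).trans (one_mul _))

lemma toBidisk_ofBidisk {A : ℝ} (hA : 1 < A)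
    {q : EuclideanSpace ℝ (Fin 2) × EuclideanSpace ℝ (Fin 2)}
    (h1 : q.1 0 ^ 2 + q.1 1 ^ 2 ≤ 1) (h2 : q.2 0 ^ 2 + q.2 1 ^ 2 ≤ 1) :
    toBidisk A (ofBidisk A q) = q := by
  have hD : 0 < A - (q.1 0 ^ 2 + q.1 1 ^ 2) * (q.2 0 ^ 2 + q.2 1 ^ 2) := by
    have := mul_le_one₀ h1 (by positivity) h2
    linarith
  obtain ⟨e1, e2⟩ := sqrt_scaling_right_inv hA (by positivity) (by positivity) h1 h2
    (sqrt_mul_sq_add (by positivity) (q.1 0) (q.1 1))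
    (sqrt_mul_sq_add (by positivity) (q.2 0) (q.2 1))
  refine Prod.ext (PiLp.ext fun i ↦ ?_) (PiLp.ext fun i ↦ ?_) <;> fin_cases i
  · exact (mul_assoc _ _ _).symm.trans ((congrArg (· * q.1 0) e1).trans (one_mul _))
  · exact (mul_assoc _ _ _).symm.trans ((congrArg (· * q.1 1) e1).trans (one_mul _))
  · exact (mul_assoc _ _ _).symm.trans ((congrArg (· * q.2 0) e2).trans (one_mul _))
  · exact (mul_assoc _ _ _).symm.trans ((congrArg (· * q.2 1) e2).trans (one_mul _))

/-- For every `A > 1`, the region `ℋ₂(A)` with the subspace topology is homeomorphic to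
`D² × D²`, the product of two closed unit disks. -/
theorem stmt_2 (A : ℝ) (hA : 1 < A) :
    Nonempty (↥(H₂ A) ≃ₜ
      ↥(Metric.closedBall (0 : EuclideanSpace ℝ (Fin 2)) 1) ×
      ↥(Metric.closedBall (0 : EuclideanSpace ℝ (Fin 2)) 1)) := by
  have hB (q : ↥(Metric.closedBall (0 : EuclideanSpace ℝ (Fin 2)) 1)) :=
    (mem_closedBall_zero_one_iff q.1).1 q.2
  refine ⟨{
    toFun p := (⟨_, (toBidisk_mem hA p.2).1⟩, ⟨_, (toBidisk_mem hA p.2).2⟩)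
    invFun q := ⟨_, ofBidisk_mem_H₂ (q := (q.1.1, q.2.1)) hA (hB q.1) (hB q.2)⟩
    left_inv p := Subtype.ext (ofBidisk_toBidisk hA p.2)
    right_inv q := ?_
    continuous_toFun := ?_
    continuous_invFun := ?_ }⟩
  · have h := toBidisk_ofBidisk (q := (q.1.1, q.2.1)) hA (hB q.1) (hB q.2)
    exact Prod.ext (Subtype.ext (congrArg Prod.fst h)) (Subtype.ext (congrArg Prod.snd h))
  · have h := (continuous_toBidisk A).comp (continuous_subtype_val (p := (· ∈ H₂ A)))
    exact (h.fst.subtype_mk _).prodMk (h.snd.subtype_mk _)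
  · exact ((continuousOn_ofBidisk hA).comp_continuous (f := fun q :
      ↥(Metric.closedBall (0 : EuclideanSpace ℝ (Fin 2)) 1) ×
      ↥(Metric.closedBall (0 : EuclideanSpace ℝ (Fin 2)) 1) ↦ (q.1.1, q.2.1)) (by fun_prop)
      fun q ↦ ⟨hB q.1, hB q.2⟩).subtype_mk _
end

section
/- For every real number A > 1, the set ℋ₂(A) = {p ∈ ℝ⁴ : f₂(p) ≥ −1 and F_A(p) ≤ 0} is a compact subset of ℝ⁴. -/
/-- Every coordinate of a point of `ℋ₂(A)` is bounded by `4 / (A - 1) + 2`. -/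
theorem abs_le_of_mem_H₂ {A : ℝ} (hA : 1 < A) {p : Fin 4 → ℝ} (hp : p ∈ H₂ A) (i : Fin 4) :
    |p i| ≤ 4 / (A - 1) + 2 := by
  obtain ⟨h₁, h₂⟩ := hp
  simp only [f₂, F] at h₁ h₂
  have hA' : 0 < A - 1 := sub_pos.2 hA
  have hx : p 0 ^ 2 + p 2 ^ 2 ≤ 2 / (A - 1) := by
    rw [le_div_iff₀ hA']
    linarith
  have hC : 4 / (A - 1) = 2 * (2 / (A - 1)) := by ring
  have hpos : 0 < 2 / (A - 1) := by positivity
  rw [hC]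
  generalize 2 / (A - 1) = c at hx hpos
  refine abs_le_of_sq_le_sq ?_ (by positivity)
  fin_cases i <;> simp only [Fin.zero_eta, Fin.mk_one, Fin.reduceFinMk] <;>
    nlinarith [sq_nonneg (p 0), sq_nonneg (p 1), sq_nonneg (p 2), sq_nonneg (p 3), sq_nonneg c]

theorem isClosed_H₂ (A : ℝ) : IsClosed (H₂ A) := by
  have hf : Continuous f₂ := by unfold f₂; fun_prop
  have hF : Continuous (F A) := by unfold F; fun_prop
  exact (isClosed_le continuous_const hf).inter (isClosed_le hF continuous_const)

/-- For every `A > 1`, the region `ℋ₂(A)` is a compact subset of `ℝ⁴`. -/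
theorem stmt_3 (A : ℝ) (hA : 1 < A) : IsCompact (H₂ A) := by
  refine (isCompact_closedBall 0 (4 / (A - 1) + 2)).of_isClosed_subset (isClosed_H₂ A) ?_
  intro p hp
  have hA' : 0 < A - 1 := sub_pos.2 hA
  rw [mem_closedBall_zero_iff, pi_norm_le_iff_of_nonneg (by positivity)]
  exact abs_le_of_mem_H₂ hA hp
end

section
/- For every open set U ⊆ ℝ⁴ containing S¹₋, there exists A₀ > 1 such that for all A ≥ A₀ one has ℋ₂(A) ∩ X₋ ⊆ U. (This is the final claim of Weinstein's handle construction lemma: by choosing A ≫ 1, the attaching region ℋ₂ ∩ X₋ can be made an arbitrarily small neighborhood of S¹₋ in X₋.) -/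
/-- The hypersurface `X₋ = f₂⁻¹(−1)`. -/
noncomputable def Xneg : Set (Fin 4 → ℝ) := {p | f₂ p = -1}

/-- The circle `S¹₋ = {(0,y₁,0,y₂) : y₁² + y₂² = 2}`. -/
def Scirc : Set (Fin 4 → ℝ) :=
  {p | p 0 = 0 ∧ p 2 = 0 ∧ p 1 ^ 2 + p 3 ^ 2 = 2}

/-- Points of `X₋` whose `x`-part has squared norm at most `2` form a compact set. -/
theorem isCompact_Xneg_inter_sq_le_two :
    IsCompact (Xneg ∩ {p : Fin 4 → ℝ | p 0 ^ 2 + p 2 ^ 2 ≤ 2}) := by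
  refine (isCompact_Icc (a := fun _ : Fin 4 => (-3 : ℝ)) (b := fun _ => 3)).of_isClosed_subset
    (IsClosed.inter ?_ ?_) ?_
  · exact isClosed_eq (by unfold f₂; fun_prop) continuous_const
  · exact isClosed_le (by fun_prop) continuous_const
  · rintro p ⟨hp, hr⟩
    simp only [Xneg, f₂, Set.mem_ofPred_eq] at hp hr
    have key : ∀ i, -3 ≤ p i ∧ p i ≤ 3 := by
      intro i
      refine abs_le.mp (abs_le_of_sq_le_sq ?_ (by norm_num))
      fin_cases i <;> simp only [Fin.zero_eta, Fin.mk_one, Fin.reduceFinMk] <;>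
        nlinarith [sq_nonneg (p 0), sq_nonneg (p 1), sq_nonneg (p 2), sq_nonneg (p 3)]
    exact ⟨fun i => (key i).1, fun i => (key i).2⟩

/-- On the attaching region the squared norm of the `x`-part is at most `2 / (A - 1)`. -/
theorem sub_one_mul_le_two_of_mem {A : ℝ} {p : Fin 4 → ℝ} (hp : p ∈ H₂ A ∩ Xneg) :
    (A - 1) * (p 0 ^ 2 + p 2 ^ 2) ≤ 2 := by
  obtain ⟨⟨-, hF⟩, hX⟩ := hp
  simp only [Xneg, f₂, F, Set.mem_ofPred_eq] at hF hX
  linarith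

/-- For every open `U ⊇ S¹₋` there exists `A₀ > 1` such that for all `A ≥ A₀`,
`ℋ₂(A) ∩ X₋ ⊆ U`: the attaching region can be made an arbitrarily small
neighborhood of `S¹₋` in `X₋` by taking `A ≫ 1`. -/
theorem stmt_6 (U : Set (Fin 4 → ℝ)) (hU : IsOpen U) (hSU : Scirc ⊆ U) :
    ∃ A₀ : ℝ, 1 < A₀ ∧ ∀ A : ℝ, A₀ ≤ A → H₂ A ∩ Xneg ⊆ U := by
  have hK := isCompact_Xneg_inter_sq_le_two.diff hU
  rcases ((Xneg ∩ {p | p 0 ^ 2 + p 2 ^ 2 ≤ 2}) \ U).eq_empty_or_nonempty.symm with hne | he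
  · obtain ⟨q, ⟨⟨hqX, -⟩, hqU⟩, hmin⟩ := hK.exists_isMinOn hne
      (f := fun p => p 0 ^ 2 + p 2 ^ 2) (by fun_prop)
    have hpos : 0 < q 0 ^ 2 + q 2 ^ 2 := by
      by_contra! h
      have h0 : q 0 = 0 := by nlinarith [sq_nonneg (q 0), sq_nonneg (q 2)]
      have h2 : q 2 = 0 := by nlinarith [sq_nonneg (q 0), sq_nonneg (q 2)]
      refine hqU (hSU ⟨h0, h2, ?_⟩)
      simp only [Xneg, f₂, Set.mem_ofPred_eq, h0, h2] at hqX
      linarith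
    set m := q 0 ^ 2 + q 2 ^ 2
    have hdiv : 0 < 2 / m := by positivity
    refine ⟨2 + 2 / m, by linarith, fun A hA p hp => ?_⟩
    by_contra hpU
    have hb := sub_one_mul_le_two_of_mem hp
    have hr : p 0 ^ 2 + p 2 ^ 2 ≤ 2 := by
      nlinarith [sq_nonneg (p 0), sq_nonneg (p 2)]
    have hm : m ≤ p 0 ^ 2 + p 2 ^ 2 := hmin ⟨⟨hp.2, hr⟩, hpU⟩
    have hc : (1 + 2 / m) * m ≤ (A - 1) * (p 0 ^ 2 + p 2 ^ 2) :=
      mul_le_mul (by linarith) hm hpos.le (by linarith)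
    have : (1 + 2 / m) * m = m + 2 := by field_simp
    linarith
  · refine ⟨2, by norm_num, fun A hA p hp => ?_⟩
    by_contra hpU
    have hb := sub_one_mul_le_two_of_mem hp
    have hr : p 0 ^ 2 + p 2 ^ 2 ≤ 2 := by
      nlinarith [sq_nonneg (p 0), sq_nonneg (p 2)]
    exact (Set.eq_empty_iff_forall_notMem.mp he) p ⟨⟨hp.2, hr⟩, hpU⟩
end

section
/- For every p ∈ ℝ⁴ with p ≠ 0, the matrix Θ(p) is symplectic: Θ(p)ᵀ · J · Θ(p) = J, where J is the matrix of the standard symplectic form. (This is the claim that the map Θ defined in the proof of the main theorem takes values in the symplectic group Sp(4).) -/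
open Matrix

/-- `N(p) = √(4x₁² + y₁² + 4x₂² + y₂²)` for `p = (x₁,y₁,x₂,y₂) ∈ ℝ⁴ = Fin 4 → ℝ`,
with coordinates `p 0 = x₁`, `p 1 = y₁`, `p 2 = x₂`, `p 3 = y₂`. -/
noncomputable def N (p : Fin 4 → ℝ) : ℝ :=
  Real.sqrt (4 * p 0 ^ 2 + p 1 ^ 2 + 4 * p 2 ^ 2 + p 3 ^ 2)

/-- The matrix `Θ(p)` from the proof of the main theorem. -/
noncomputable def Θ (p : Fin 4 → ℝ) : Matrix (Fin 4) (Fin 4) ℝ :=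
  (N p)⁻¹ •
    !![2 * p 0,   p 1, -2 * p 2,      p 3;
         -p 1, 2 * p 0,     -p 3, -2 * p 2;
       2 * p 2,   p 3,  2 * p 0,     -p 1;
         -p 3, 2 * p 2,      p 1,  2 * p 0]

/-- The matrix `J` of the standard symplectic form `dx₁∧dy₁ + dx₂∧dy₂`. -/
def Jst : Matrix (Fin 4) (Fin 4) ℝ :=
  !![0, 1, 0, 0;
    -1, 0, 0, 0;
     0, 0, 0, 1;
     0, 0, -1, 0]

theorem N_sq (p : Fin 4 → ℝ) :
    N p ^ 2 = 4 * p 0 ^ 2 + p 1 ^ 2 + 4 * p 2 ^ 2 + p 3 ^ 2 :=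
  Real.sq_sqrt (by positivity)

theorem N_ne_zero {p : Fin 4 → ℝ} (hp : p ≠ 0) : N p ≠ 0 := by
  contrapose! hp
  have h := N_sq p
  rw [hp] at h
  ext i
  refine pow_eq_zero_iff two_ne_zero |>.mp ?_
  fin_cases i <;> dsimp <;>
    nlinarith [sq_nonneg (p 0), sq_nonneg (p 1), sq_nonneg (p 2), sq_nonneg (p 3)]

/-- For every `p ≠ 0`, `Θ(p)` is symplectic: `Θ(p)ᵀ · J · Θ(p) = J`. -/
theorem stmt_11 (p : Fin 4 → ℝ) (hp : p ≠ 0) :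
    (Θ p)ᵀ * Jst * Θ p = Jst := by
  have h : (N p)⁻¹ ^ 2 * (4 * p 0 ^ 2 + p 1 ^ 2 + 4 * p 2 ^ 2 + p 3 ^ 2) = 1 := by
    rw [← N_sq, ← mul_pow, inv_mul_cancel₀ (N_ne_zero hp), one_pow]
  ext i j
  fin_cases i <;> fin_cases j <;>
    simp [Θ, Jst, Matrix.mul_apply, Fin.sum_univ_four] <;> grind
end

section
/- For every p ∈ ℝ⁴ with p ≠ 0, the matrix Θ(p) is special orthogonal: Θ(p)ᵀ · Θ(p) = I (the 4×4 identity matrix) and det Θ(p) = 1. -/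
open Matrix

/-- For every `p ≠ 0`, `Θ(p)` is special orthogonal: `Θ(p)ᵀ · Θ(p) = I` and
`det Θ(p) = 1`. -/
theorem stmt_12 (p : Fin 4 → ℝ) (hp : p ≠ 0) :
    (Θ p)ᵀ * Θ p = 1 ∧ (Θ p).det = 1 := by
  have hN := N_sq p
  have h0 := N_ne_zero hp
  refine ⟨?_, ?_⟩
  · rw [Θ, transpose_smul, smul_mul_smul_comm, ← mul_inv, ← sq, inv_smul_eq_iff₀ (pow_ne_zero 2 h0),
      hN]
    ext i j
    fin_cases i <;> fin_cases j <;> simp [mul_apply, Fin.sum_univ_four] <;> ring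
  · rw [Θ, det_smul, Fintype.card_fin, inv_pow, inv_mul_eq_one₀ (pow_ne_zero 4 h0),
      show N p ^ 4 = (N p ^ 2) ^ 2 by ring, hN]
    simp [det_succ_row_zero, Fin.sum_univ_succ, Fin.succAbove]
    ring
end
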